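/- Let K be a field with char(K) = 0 and f ∈ K[x] with deg f > 1. Then f is indecomposable over K if and only if the monodromy group Mon(f) is a primitive permutation group. -/

import Mathlib

open Polynomial

noncomputable section

/-- The polynomial `f(X) - t` over `K(t)`, whose Galois group (viewed as a permutation group
of the roots in a splitting field) is the monodromy group `Mon(f)` of `f`. -/
def monodromyPoly (K : Type*) [Field K] (f : K[X]) : Polynomial (RatFunc K) :=
  f.map (algebraMap K (RatFunc K)) - C RatFunc.X

/-- A group action is primitive if it is transitive and preserves no nontrivial partition,
i.e. every block is trivial (a subsingleton or the whole set). -/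
def IsPrimitiveAction (G α : Type*) [Group G] [MulAction G α] : Prop :=
  MulAction.IsPretransitive G α ∧
    ∀ B : Set α, (∀ g : G, (fun x => g • x) '' B = B ∨ Disjoint ((fun x => g • x) '' B) B) →
      B.Subsingleton ∨ B = Set.univ

/-- `f` is indecomposable: it is not a composition of two polynomials of degree `> 1`. -/
def Indecomposable {K : Type*} [Field K] (f : K[X]) : Prop :=
  ¬ ∃ g h : K[X], 1 < g.natDegree ∧ 1 < h.natDegree ∧ f = g.comp h

/-- The polynomial `p(Y) - p(X)` in the variable `Y` over `K(X)`. -/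
def subSelf {K : Type*} [Field K] (p : K[X]) : (RatFunc K)[X] :=
  p.map (algebraMap K (RatFunc K)) - C (algebraMap K[X] (RatFunc K) p)

section RationalFunctions

variable {K : Type*} [Field K]

lemma subSelf_coeff_of_ne_zero (p : K[X]) {i : ℕ} (hi : i ≠ 0) :
    (subSelf p).coeff i = algebraMap K (RatFunc K) (p.coeff i) := by
  simp [subSelf, coeff_C, hi]

lemma natDegree_subSelf (p : K[X]) : (subSelf p).natDegree = p.natDegree := by
  rw [subSelf, natDegree_sub_C, natDegree_map]

lemma subSelf_C_mul (a : K) (p : K[X]) :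
    subSelf (C a * p) = C (algebraMap K (RatFunc K) a) * subSelf p := by
  have : algebraMap K[X] (RatFunc K) (C a) = algebraMap K (RatFunc K) a := by
    rw [← Polynomial.algebraMap_eq, ← IsScalarTower.algebraMap_apply]
  simp [subSelf, mul_sub, this]

lemma subSelf_monic {p : K[X]} (hp : p.Monic) (hd : 0 < p.natDegree) : (subSelf p).Monic := by
  rw [Monic, leadingCoeff, natDegree_subSelf, subSelf_coeff_of_ne_zero _ hd.ne']
  simp [hp.coeff_natDegree]

lemma eq_C_of_subSelf_eq_zero {p : K[X]} (h : subSelf p = 0) : p = C (p.coeff 0) := by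
  apply eq_C_of_natDegree_eq_zero
  rw [← natDegree_subSelf, h, natDegree_zero]

/-- A monic factor over the fraction field of a monic polynomial over an integrally closed domain
has coefficients in the domain. -/
lemma Polynomial.Monic.mem_lifts_of_dvd_map {R F : Type*} [CommRing R] [IsDomain R]
    [IsIntegrallyClosed R] [Field F] [Algebra R F] [IsFractionRing R F] {p : R[X]} (hp : p.Monic)
    {q : F[X]} (hq : q.Monic) (hd : q ∣ p.map (algebraMap R F)) :
    ∃ q' : R[X], q'.map (algebraMap R F) = q := by
  obtain ⟨q', h⟩ := IsIntegrallyClosed.eq_map_mul_C_of_dvd F hp hd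
  exact ⟨q', by simpa [hq.leadingCoeff] using h⟩

lemma exists_polynomial_coeff_of_dvd_subSelf {p : K[X]} (hp : p.Monic) (hd : 0 < p.natDegree)
    {q : (RatFunc K)[X]} (hq : q.Monic) (h : q ∣ subSelf p) (i : ℕ) :
    ∃ c : K[X], algebraMap K[X] (RatFunc K) c = q.coeff i := by
  have hmap : (p.map C - C p).map (algebraMap K[X] (RatFunc K)) = subSelf p := by
    rw [Polynomial.map_sub, Polynomial.map_map, map_C]
    rfl
  have hmon : (p.map C - C p).Monic :=
    Polynomial.monic_of_injective (IsFractionRing.injective K[X] (RatFunc K))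
      (hmap ▸ subSelf_monic hp hd)
  obtain ⟨q', rfl⟩ := hmon.mem_lifts_of_dvd_map hq (hmap ▸ h)
  exact ⟨q'.coeff i, by simp⟩

open Classical in
lemma inftyValuation_algebraMap_le {p : K[X]} {n : ℕ} (hn : p.natDegree ≤ n) :
    RatFunc.inftyValuation K (algebraMap K[X] (RatFunc K) p) ≤ WithZero.exp (n : ℤ) := by
  rcases eq_or_ne p 0 with rfl | hp
  · simp
  · rw [RatFunc.inftyValuation_apply, RatFunc.inftyValuation.polynomial K hp, WithZero.exp_le_exp]
    exact_mod_cast hn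

open Classical in
lemma inftyValuation_X_inv_pow (n : ℕ) :
    RatFunc.inftyValuation K ((RatFunc.X)⁻¹ ^ n) = WithZero.exp (-(n : ℤ)) := by
  rw [inv_pow, ← zpow_natCast, ← zpow_neg, RatFunc.inftyValuation.X_zpow]

lemma natDegree_le_of_coeff_dvd_subSelf {p : K[X]} (hp : p.Monic) (hd : 0 < p.natDegree)
    {q : (RatFunc K)[X]} (hq : q.Monic) (h : q ∣ subSelf p) {i : ℕ} (hi : i ≤ q.natDegree)
    {c : K[X]} (hc : algebraMap K[X] (RatFunc K) c = q.coeff i) : c.natDegree + i ≤ q.natDegree := by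
  classical
  let V := (RatFunc.inftyValuation K).valuationSubring
  have hV : ∀ j, ((subSelf p).scaleRoots (RatFunc.X)⁻¹).coeff j ∈ V := by
    intro j
    rw [Valuation.mem_valuationSubring_iff, coeff_scaleRoots, natDegree_subSelf, map_mul,
      inftyValuation_X_inv_pow]
    rcases eq_or_ne j 0 with rfl | hj
    · have : (subSelf p).coeff 0 = algebraMap K[X] (RatFunc K) (C (p.coeff 0) - p) := by
        simp only [subSelf, coeff_sub, coeff_map, coeff_C_zero, map_sub]
        rw [← Polynomial.algebraMap_eq, ← IsScalarTower.algebraMap_apply]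
      rw [this]
      refine (mul_le_mul_left (inftyValuation_algebraMap_le (n := p.natDegree) ?_) _).trans ?_
      · exact (natDegree_sub_le _ _).trans (by simp)
      · rw [← WithZero.exp_add]; simp
    · rw [subSelf_coeff_of_ne_zero _ hj, IsScalarTower.algebraMap_apply K K[X] (RatFunc K)]
      refine (mul_le_mul_left (inftyValuation_algebraMap_le (n := 0) (by simp)) _).trans ?_
      rw [← WithZero.exp_add, ← WithZero.exp_zero, WithZero.exp_le_exp]
      simp
  obtain ⟨P, hP⟩ : ∃ P : V[X],
      P.map (algebraMap V (RatFunc K)) = (subSelf p).scaleRoots (RatFunc.X)⁻¹ := by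
    rw [← mem_lifts, lifts_iff_coeff_lifts]
    exact fun j => ⟨⟨_, hV j⟩, rfl⟩
  have hmon : P.Monic := Polynomial.monic_of_injective (IsFractionRing.injective V (RatFunc K))
    (hP ▸ (monic_scaleRoots_iff _).2 (subSelf_monic hp hd))
  obtain ⟨Q, hQ⟩ := hmon.mem_lifts_of_dvd_map ((monic_scaleRoots_iff (RatFunc.X)⁻¹).2 hq)
    (hP ▸ scaleRoots_dvd _ _ h)
  rcases eq_or_ne c 0 with rfl | hc0
  · simpa using hi
  have hle : RatFunc.inftyValuation K ((q.scaleRoots (RatFunc.X)⁻¹).coeff i) ≤ 1 := by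
    rw [← hQ, coeff_map]
    exact (Q.coeff i).2
  rw [coeff_scaleRoots, ← hc, map_mul, inftyValuation_X_inv_pow, RatFunc.inftyValuation_apply,
    RatFunc.inftyValuation.polynomial K hc0, ← WithZero.exp_add, ← WithZero.exp_zero,
    WithZero.exp_le_exp] at hle
  omega

/-- Expansion of `p` in the basis `1, X, …, X ^ (deg h - 1)` of `K[X]` over `K[h]`. -/
lemma exists_sum_X_pow_mul_comp {h : K[X]} (hh : h.Monic) (hd : 0 < h.natDegree) (p : K[X]) :
    ∃ b : ℕ → K[X], p = ∑ k ∈ Finset.range h.natDegree, X ^ k * (b k).comp h := by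
  induction hn : p.natDegree using Nat.strong_induction_on generalizing p with
  | _ n ih =>
    subst hn
    have hr : (p %ₘ h).natDegree < h.natDegree :=
      natDegree_modByMonic_lt _ hh (by rintro rfl; simp at hd)
    have hsum := (p %ₘ h).as_sum_range' _ hr
    rcases Nat.eq_zero_or_pos p.natDegree with h0 | h0
    · refine ⟨fun k => C ((p %ₘ h).coeff k), ?_⟩
      have hp : p %ₘ h = p := (modByMonic_eq_self_iff hh).2
        (degree_lt_degree (by omega))
      conv_lhs => rw [← hp, hsum]
      refine Finset.sum_congr rfl fun k _ => ?_
      rw [C_comp, ← C_mul_X_pow_eq_monomial, mul_comm]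
    · obtain ⟨b, hb⟩ := ih _ (by rw [natDegree_divByMonic _ hh]; omega) (p /ₘ h) rfl
      refine ⟨fun k => C ((p %ₘ h).coeff k) + X * b k, ?_⟩
      conv_lhs => rw [← modByMonic_add_div p h, hsum, hb]
      rw [Finset.mul_sum, ← Finset.sum_add_distrib]
      refine Finset.sum_congr rfl fun k _ => ?_
      simp only [add_comp, C_comp, mul_comp, X_comp, ← C_mul_X_pow_eq_monomial]
      ring

lemma exists_eq_comp_of_subSelf_dvd {h : K[X]} (hh : h.Monic) (hd : 0 < h.natDegree) {p : K[X]}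
    (hp : subSelf h ∣ subSelf p) : ∃ g : K[X], p = g.comp h := by
  obtain ⟨b, hb⟩ := exists_sum_X_pow_mul_comp hh hd p
  set A := algebraMap K[X] (RatFunc K)
  set κ := algebraMap K (RatFunc K)
  let R : (RatFunc K)[X] := ∑ k ∈ Finset.range h.natDegree, C (A ((b k).comp h)) * X ^ k
  have hAcomp (g : K[X]) : A (g.comp h) = (g.map κ).eval (A h) := by
    rw [comp, eval_map, hom_eval₂]; rfl
  have hmod : subSelf h ∣ p.map κ - R := by
    conv_rhs => rw [hb]
    rw [Polynomial.map_sum, ← Finset.sum_sub_distrib]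
    refine Finset.dvd_sum fun k _ => ?_
    have := (sub_dvd_eval_sub (h.map κ) (C (A h)) (((b k).map κ).map C)).mul_left (X ^ k)
    refine this.trans (dvd_of_eq ?_)
    rw [hAcomp, eval_map, eval_map, eval₂_at_apply, Polynomial.map_mul, Polynomial.map_pow, map_X,
      Polynomial.map_comp, comp]
    ring
  have hzero : R - C (A p) = 0 := by
    by_contra hne
    have hdvd : subSelf h ∣ R - C (A p) := by
      have : R - C (A p) = subSelf p - (p.map κ - R) := by rw [subSelf]; ring
      rw [this]
      exact dvd_sub hp hmod
    have hlt : (R - C (A p)).degree < h.natDegree := by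
      refine (degree_sub_le _ _).trans_lt (max_lt ?_ ?_)
      · refine (degree_sum_le _ _).trans_lt ((Finset.sup_lt_iff (WithBot.bot_lt_coe _)).2 ?_)
        intro k hk
        exact (degree_C_mul_X_pow_le _ _).trans_lt (by exact_mod_cast Finset.mem_range.1 hk)
      · exact degree_C_le.trans_lt (by exact_mod_cast hd)
    have := degree_le_of_dvd hdvd hne
    rw [degree_eq_natDegree (subSelf_monic hh hd).ne_zero, natDegree_subSelf] at this
    exact absurd hlt (not_lt.2 this)
  have hb0 : ∀ k ∈ Finset.range h.natDegree, k ≠ 0 → (b k).comp h = 0 := by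
    intro k hk hk0
    have := congrArg (fun P : (RatFunc K)[X] => P.coeff k) hzero
    simp only [R, coeff_sub, finsetSum_coeff, coeff_C_mul_X_pow, coeff_C, hk0, if_false, sub_zero,
      coeff_zero, Finset.sum_ite_eq, hk, if_true] at this
    exact IsFractionRing.injective K[X] (RatFunc K) (by rw [map_zero]; exact this)
  refine ⟨b 0, ?_⟩
  conv_lhs => rw [hb]
  rw [Finset.sum_eq_single 0]
  · simp
  · intro k hk hk0
    rw [hb0 k hk hk0, mul_zero]
  · intro h0
    exact absurd (Finset.mem_range.2 hd) h0

/-- Let `q` be a monic factor of `f(Y) - f(X)` over `K(X)`, vanishing at `X`, which divides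
`c(Y) - c(X)` for each coefficient `c` of `q`. Then `f = g ∘ h` with `deg h = deg q`. -/
lemma exists_comp_of_dvd_subSelf {f : K[X]} (hf : 0 < f.natDegree)
    {q : (RatFunc K)[X]} (hq : q.Monic) (hd : 0 < q.natDegree) (h : q ∣ subSelf f)
    (hX : q.eval RatFunc.X = 0)
    (hcoeff : ∀ i (c : K[X]), algebraMap K[X] (RatFunc K) c = q.coeff i → q ∣ subSelf c) :
    ∃ g h : K[X], h.natDegree = q.natDegree ∧ f = g.comp h := by
  have hf0 : f ≠ 0 := by rintro rfl; simp at hf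
  set f₁ := C f.leadingCoeff⁻¹ * f
  have hf₁ : f₁.Monic := by
    rw [show f₁ = f * C f.leadingCoeff⁻¹ from mul_comm _ _]
    exact monic_mul_leadingCoeff_inv hf0
  have hdeg₁ : 0 < f₁.natDegree := by
    rwa [natDegree_C_mul (inv_ne_zero (leadingCoeff_ne_zero.2 hf0))]
  have h₁ : q ∣ subSelf f₁ := by
    rw [subSelf_C_mul]
    exact h.mul_left _
  have hconst (i : ℕ) (hi : i ≠ 0) : ∃ a : K, algebraMap K (RatFunc K) a = q.coeff i := by
    obtain ⟨c, hc⟩ := exists_polynomial_coeff_of_dvd_subSelf hf₁ hdeg₁ hq h₁ i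
    rcases lt_or_ge q.natDegree i with hlt | hle
    · exact ⟨0, by rw [coeff_eq_zero_of_natDegree_lt hlt, map_zero]⟩
    have hcd := natDegree_le_of_coeff_dvd_subSelf hf₁ hdeg₁ hq h₁ hle hc
    have hz : subSelf c = 0 := by
      by_contra hne
      have := natDegree_le_of_dvd (hcoeff i c hc) hne
      rw [natDegree_subSelf] at this
      omega
    refine ⟨c.coeff 0, ?_⟩
    rw [← hc, IsScalarTower.algebraMap_apply K K[X] (RatFunc K), Polynomial.algebraMap_eq,
      ← eq_C_of_subSelf_eq_zero hz]
  obtain ⟨r, hr⟩ : ∃ r : K[X], r.map (algebraMap K (RatFunc K)) = q - C (q.coeff 0) := by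
    rw [← mem_lifts, lifts_iff_coeff_lifts]
    intro i
    rcases eq_or_ne i 0 with rfl | hi
    · exact ⟨0, by simp⟩
    · obtain ⟨a, ha⟩ := hconst i hi
      exact ⟨a, by simp only [ha, coeff_sub, coeff_C, hi, if_false, sub_zero]⟩
  have hrd : r.natDegree = q.natDegree := by
    rw [← natDegree_map (algebraMap K (RatFunc K)), hr, natDegree_sub_C]
  have hqr : q = subSelf r := by
    have hev : algebraMap K[X] (RatFunc K) r = (r.map (algebraMap K (RatFunc K))).eval RatFunc.X := by
      conv_lhs => rw [← comp_X (p := r)]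
      rw [comp, eval_map, hom_eval₂, RatFunc.algebraMap_X]; rfl
    rw [subSelf, hev, hr, eval_sub, hX, eval_C]
    simp
  have hrm : r.Monic := by
    rw [Monic, leadingCoeff, hrd]
    apply (algebraMap K (RatFunc K)).injective
    rw [← subSelf_coeff_of_ne_zero r hd.ne', ← hqr, hq.coeff_natDegree, map_one]
  obtain ⟨g, hg⟩ := exists_eq_comp_of_subSelf_dvd hrm (hrd ▸ hd) (hqr ▸ h)
  exact ⟨g, r, hrd, hg⟩

end RationalFunctions

section MonodromyPoly

variable {K : Type*} [Field K]

lemma monodromyPoly_eq_map (f : K[X]) :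
    monodromyPoly K f = (f.map C - C X).map (algebraMap K[X] (RatFunc K)) := by
  rw [Polynomial.map_sub, Polynomial.map_map, map_C, RatFunc.algebraMap_X]
  rfl

lemma natDegree_monodromyPoly (f : K[X]) : (monodromyPoly K f).natDegree = f.natDegree := by
  rw [monodromyPoly, natDegree_sub_C, natDegree_map]

lemma irreducible_monodromyPoly {f : K[X]} (hf : 0 < f.natDegree) :
    Irreducible (monodromyPoly K f) := by
  have hirr : Irreducible (f.map C - C X) := by
    rw [← MulEquiv.irreducible_iff (Bivariate.swap (R := K)), map_sub, Bivariate.swap_map_C,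
      Bivariate.swap_X, ← neg_sub]
    exact (Associated.refl _).neg_left.irreducible_iff.2 (prime_X_sub_C f).irreducible
  have hdeg : (f.map C - C X).natDegree = f.natDegree := by
    rw [natDegree_sub_C, natDegree_map_eq_of_injective C_injective]
  rw [monodromyPoly_eq_map]
  exact ((hirr.isPrimitive (by omega)).irreducible_iff_irreducible_map_fraction_map).1 hirr

variable {L : Type*} [Field L] [Algebra K L] [Algebra (RatFunc K) L]
  [IsScalarTower K (RatFunc K) L]

lemma map_monodromyPoly (f : K[X]) : (monodromyPoly K f).map (algebraMap (RatFunc K) L) =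
    f.map (algebraMap K L) - C (algebraMap (RatFunc K) L RatFunc.X) := by
  rw [monodromyPoly, Polynomial.map_sub, map_C, Polynomial.map_map,
    ← IsScalarTower.algebraMap_eq]

lemma mem_rootSet_monodromyPoly {f : K[X]} (hf : 0 < f.natDegree) {x : L} :
    x ∈ (monodromyPoly K f).rootSet L ↔ aeval x f = algebraMap (RatFunc K) L RatFunc.X := by
  rw [mem_rootSet, aeval_def, ← eval_map, map_monodromyPoly, eval_sub, eval_C, eval_map_algebraMap,
    sub_eq_zero]
  exact and_iff_right (irreducible_monodromyPoly hf).ne_zero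

/-- A root `x` of `f(Y) - t` yields an embedding of `K(X)` sending `X` to `x`, whose image contains
`K(t)`. -/
lemma exists_ringHom_of_aeval_eq {f : K[X]} {x : L}
    (hx : aeval x f = algebraMap (RatFunc K) L RatFunc.X) :
    ∃ φ : RatFunc K →+* L, (∀ p : K[X], φ (algebraMap K[X] (RatFunc K) p) = aeval x p) ∧
      ∀ r, algebraMap (RatFunc K) L r ∈ φ.fieldRange := by
  have hpoly (p : K[X]) : algebraMap (RatFunc K) L (algebraMap K[X] (RatFunc K) p) =
      aeval x (p.comp f) := by
    rw [aeval_comp, hx, aeval_algebraMap_apply, ← RatFunc.algebraMap_X, aeval_algebraMap_apply,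
      aeval_X_left_apply]
  have htr : Function.Injective (aeval (R := K) x) := by
    rw [← transcendental_iff_injective]
    refine (transcendental_aeval_iff (f := f).1 ?_).1
    rw [hx, transcendental_algebraMap_iff (algebraMap (RatFunc K) L).injective]
    exact RatFunc.transcendental_X
  refine ⟨IsFractionRing.lift (A := K[X]) (g := (aeval (R := K) x).toRingHom) htr,
    fun p => IsFractionRing.lift_algebraMap _ _, fun r => ?_⟩
  rw [← RatFunc.num_div_denom r, map_div₀, hpoly, hpoly]
  refine div_mem ⟨algebraMap K[X] (RatFunc K) (r.num.comp f), ?_⟩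
    ⟨algebraMap K[X] (RatFunc K) (r.denom.comp f), ?_⟩ <;>
  exact IsFractionRing.lift_algebraMap _ _

open IntermediateField in
/-- A block `S` of roots of `f(Y) - t` gives a decomposition `f = g ∘ h` with `deg h = |S|`. -/
lemma exists_comp_of_block [FiniteDimensional (RatFunc K) L] [IsGalois (RatFunc K) L] {f : K[X]}
    (hf : 0 < f.natDegree) {S : Finset L} {x : L} (hxS : x ∈ S)
    (hS : ∀ y ∈ S, aeval y f = algebraMap (RatFunc K) L RatFunc.X)
    (hblock : ∀ σ : L ≃ₐ[RatFunc K] L, σ x ∈ S → ∀ z ∈ S, σ z ∈ S)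
    (htrans : ∀ y ∈ S, ∃ σ : L ≃ₐ[RatFunc K] L, σ x = y) :
    ∃ g h : K[X], h.natDegree = S.card ∧ f = g.comp h := by
  classical
  obtain ⟨φ, hφ, hφrange⟩ := exists_ringHom_of_aeval_eq (hS x hxS)
  set Q : L[X] := ∏ y ∈ S, (X - C y)
  have hQmonic : Q.Monic := monic_prod_of_monic _ _ fun y _ => monic_X_sub_C y
  have hQmap (σ : L ≃ₐ[RatFunc K] L) (hσ : σ x ∈ S) : Q.map (σ : L →+* L) = Q := by
    have himg : S.image σ = S := Finset.eq_of_subset_of_card_le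
      (Finset.image_subset_iff.2 (hblock σ hσ)) (Finset.card_image_of_injective _ σ.injective).ge
    change _ = ∏ y ∈ S, (X - C y)
    conv_rhs => rw [← himg]
    rw [Polynomial.map_prod, Finset.prod_image σ.injective.injOn]
    simp
  have hfix (σ : L ≃ₐ[RatFunc K] L) (hσ : σ x ∈ S) (i : ℕ) : σ (Q.coeff i) = Q.coeff i := by
    conv_rhs => rw [← hQmap σ hσ, coeff_map]
    rfl
  have hrange (i : ℕ) : Q.coeff i ∈ φ.fieldRange := by
    have hle : (RatFunc K)⟮x⟯ ≤ φ.fieldRange.toIntermediateField hφrange := by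
      rw [adjoin_simple_le_iff]
      exact ⟨algebraMap K[X] (RatFunc K) X, by rw [hφ, aeval_X]⟩
    apply hle
    rw [← IsGalois.fixedField_fixingSubgroup (RatFunc K)⟮x⟯, mem_fixedField_iff]
    intro σ hσ
    refine hfix σ ?_ i
    rw [(mem_fixingSubgroup_iff _ _).1 hσ x (mem_adjoin_simple_self _ x)]
    exact hxS
  obtain ⟨q, hq⟩ : ∃ q : (RatFunc K)[X], q.map φ = Q := by
    rw [← mem_lifts, lifts_iff_coeff_lifts]
    exact hrange
  have hφK : φ.comp (algebraMap K (RatFunc K)) = algebraMap K L := by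
    ext a
    rw [RingHom.comp_apply, IsScalarTower.algebraMap_apply K K[X] (RatFunc K), hφ,
      Polynomial.algebraMap_eq, aeval_C]
  have hdvd {c : K[X]} (hc : ∀ y ∈ S, aeval y c = aeval x c) : q ∣ subSelf c := by
    rw [← Polynomial.map_dvd_map' φ, hq]
    refine Finset.prod_dvd_of_coprime
      ((pairwise_coprime_X_sub_C Function.injective_id).set_pairwise _) fun y hy => ?_
    rw [dvd_iff_isRoot, IsRoot, subSelf, Polynomial.map_sub, map_C, Polynomial.map_map, hφK, hφ,
      eval_sub, eval_C, eval_map_algebraMap, hc y hy, sub_self]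
  have hqd : q.natDegree = S.card := by
    rw [← natDegree_map φ, hq, natDegree_prod_of_monic _ _ fun y _ => monic_X_sub_C y]
    simp
  rw [← hqd]
  refine exists_comp_of_dvd_subSelf hf (monic_of_injective φ.injective (hq ▸ hQmonic))
    (hqd ▸ Finset.card_pos.2 ⟨x, hxS⟩) (hdvd fun y hy => by rw [hS y hy, hS x hxS]) ?_ ?_
  · apply φ.injective
    rw [map_zero, ← eval₂_at_apply, ← eval_map, hq, eval_prod]
    refine Finset.prod_eq_zero hxS ?_
    rw [← RatFunc.algebraMap_X, hφ]
    simp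
  · intro i c hc
    refine hdvd fun y hy => ?_
    obtain ⟨σ, rfl⟩ := htrans y hy
    have hci : aeval x c = Q.coeff i := by rw [← hφ, hc, ← hq, coeff_map]
    have hσ : aeval (σ x) c = σ (aeval x c) :=
      aeval_algHom_apply (σ.toAlgHom.restrictScalars K) x c
    rw [hσ, hci, hfix σ hy]

/-- If `f = g ∘ h` and `x` is a root of `f(Y) - t` then `h(Y) - h(x)` has `deg h` roots, all of
which are roots of `f(Y) - t`. -/
lemma exists_finset_of_comp [CharZero K] {g h : K[X]} (hf : 0 < (g.comp h).natDegree)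
    (hL : ((monodromyPoly K (g.comp h)).map (algebraMap (RatFunc K) L)).Splits) {x : L}
    (hx : x ∈ (monodromyPoly K (g.comp h)).rootSet L) :
    ∃ S : Finset L, S.card = h.natDegree ∧ ∀ y, y ∈ S ↔
      y ∈ (monodromyPoly K (g.comp h)).rootSet L ∧ aeval y h = aeval x h := by
  classical
  set p := monodromyPoly K (g.comp h)
  have hp : p.map (algebraMap (RatFunc K) L) ≠ 0 :=
    Polynomial.map_ne_zero (irreducible_monodromyPoly hf).ne_zero
  have hsep : (p.map (algebraMap (RatFunc K) L)).Separable :=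
    (irreducible_monodromyPoly hf).separable.map
  have hgx : (g.map (algebraMap K L)).eval (aeval x h) = algebraMap (RatFunc K) L RatFunc.X := by
    rw [eval_map_algebraMap, ← aeval_comp]
    exact (mem_rootSet_monodromyPoly hf).1 hx
  set H : L[X] := h.map (algebraMap K L) - C (aeval x h)
  have hHdvd : H ∣ p.map (algebraMap (RatFunc K) L) := by
    refine (sub_dvd_eval_sub (h.map (algebraMap K L)) (C (aeval x h))
      ((g.map (algebraMap K L)).map C)).trans (dvd_of_eq ?_)
    rw [map_monodromyPoly, eval_map, eval_map, eval₂_at_apply, hgx, Polynomial.map_comp, comp]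
  have hHd : H.natDegree = h.natDegree := by rw [natDegree_sub_C, natDegree_map]
  refine ⟨H.roots.toFinset, ?_, fun y => ?_⟩
  · rw [Multiset.toFinset_card_of_nodup (nodup_roots (hsep.of_dvd hHdvd)),
      ← (hL.of_dvd hp hHdvd).natDegree_eq_card_roots, hHd]
  · have hroot : H.IsRoot y ↔ aeval y h = aeval x h := by
      rw [IsRoot, eval_sub, eval_C, eval_map_algebraMap, sub_eq_zero]
    rw [Multiset.mem_toFinset, mem_roots (ne_zero_of_dvd_ne_zero hp hHdvd), hroot]
    refine ⟨fun hy => ⟨?_, hy⟩, And.right⟩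
    rw [mem_rootSet_monodromyPoly hf, aeval_comp, hy, ← eval_map_algebraMap, hgx]

end MonodromyPoly

/-- **Lemma (Ritt, Fried).** Let `char K = 0` and `f ∈ K[x]` with `deg f > 1`. Then `f` is
indecomposable over `K` iff its monodromy group is a primitive permutation group. -/
theorem stmt8 {K : Type*} [Field K] [CharZero K] (f : K[X]) (hf : 1 < f.natDegree) :
    Indecomposable f ↔
      IsPrimitiveAction (monodromyPoly K f).Gal
        ((monodromyPoly K f).rootSet (monodromyPoly K f).SplittingField) := by
  classical
  set p := monodromyPoly K f
  have hf0 : 0 < f.natDegree := by omega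
  have hirr : Irreducible p := irreducible_monodromyPoly hf0
  have hsep : p.Separable := hirr.separable
  have hsplits := SplittingField.splits p
  have hcard : Nat.card (p.rootSet p.SplittingField) = f.natDegree := by
    rw [Nat.card_eq_fintype_card, card_rootSet_eq_natDegree hsep hsplits, natDegree_monodromyPoly]
  have : IsGalois (RatFunc K) p.SplittingField := IsGalois.of_separable_splitting_field hsep
  have hsmul (σ : p.Gal) (y : p.rootSet p.SplittingField) :
      ((σ • y : p.rootSet p.SplittingField) : p.SplittingField) = σ y := rfl
  have htrans : ∀ x y : p.rootSet p.SplittingField, ∃ σ : p.Gal, σ • x = y := by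
    intro x y
    have hx := minpoly.eq_of_irreducible hirr (mem_rootSet.mp x.2).2
    have hy := minpoly.eq_of_irreducible hirr (mem_rootSet.mp y.2).2
    obtain ⟨σ, hσ⟩ := (Normal.minpoly_eq_iff_mem_orbit p.SplittingField).mp (hy.symm.trans hx)
    exact ⟨σ, Subtype.ext hσ⟩
  constructor
  · refine fun hind => ⟨⟨htrans⟩, fun B hB => ?_⟩
    by_contra! hcon
    obtain ⟨hnontriv, huniv⟩ := hcon
    obtain ⟨x, hx⟩ := hnontriv.nonempty
    have hmem (σ : p.Gal) (hσ : σ • x ∈ B) : ∀ z ∈ B, σ • z ∈ B := by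
      intro z hz
      rcases hB σ with h | h
      · rw [← h]
        exact ⟨z, hz, rfl⟩
      · exact absurd hσ (Set.disjoint_left.1 h ⟨x, hx, rfl⟩)
    let S : Finset p.SplittingField := B.toFinset.map (Function.Embedding.subtype _)
    have hS (y : p.rootSet p.SplittingField) : (y : p.SplittingField) ∈ S ↔ y ∈ B := by
      simp [S]
    have hS' : ∀ y ∈ S, ∃ z ∈ B, (z : p.SplittingField) = y := by
      intro y hy
      simpa [S] using hy
    obtain ⟨g, h, hh, hgh⟩ := exists_comp_of_block (S := S) (x := x) hf0 ((hS x).2 hx)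
      (fun y hy => by
        obtain ⟨z, -, rfl⟩ := hS' y hy
        exact (mem_rootSet_monodromyPoly hf0).1 z.2)
      (fun σ hσ z hz => by
        obtain ⟨z, -, rfl⟩ := hS' z hz
        exact (hS _).2 (hmem σ ((hS (HSMul.hSMul (α := p.Gal) σ x)).1 hσ) z ((hS z).1 hz)))
      (fun y hy => by
        obtain ⟨z, -, rfl⟩ := hS' y hy
        obtain ⟨σ, hσ⟩ := htrans x z
        exact ⟨σ, congrArg Subtype.val hσ⟩)
    have hScard : S.card = B.ncard := by
      rw [Finset.card_map, Set.ncard_eq_toFinset_card']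
    have h1 : 1 < B.ncard := (Set.one_lt_ncard_iff_nontrivial).2 hnontriv
    have h2 : B.ncard < f.natDegree := by
      rw [← hcard, ← Set.ncard_univ]
      exact Set.ncard_lt_ncard (Set.ssubset_univ_iff.2 huniv)
    refine hind ⟨g, h, ?_, by omega, hgh⟩
    rw [hgh, natDegree_comp, hh, hScard] at h2
    by_contra! hg
    nlinarith
  · rintro ⟨-, hprim⟩ ⟨g, h, hg, hh, rfl⟩
    obtain ⟨x⟩ : Nonempty (p.rootSet p.SplittingField) := by
      rw [← Fintype.card_pos_iff, ← Nat.card_eq_fintype_card, hcard]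
      exact hf0
    obtain ⟨S, hScard, hS⟩ := exists_finset_of_comp hf0 hsplits x.2
    have haeval (σ : p.Gal) (y : p.SplittingField) : aeval (σ y) h = σ (aeval y h) :=
      aeval_algHom_apply ((AlgEquiv.toAlgHom σ).restrictScalars K) y h
    let B : Set (p.rootSet p.SplittingField) :=
      {y | aeval (y : p.SplittingField) h = aeval (x : p.SplittingField) h}
    have hB (y : p.rootSet p.SplittingField) : y ∈ B ↔
        aeval (y : p.SplittingField) h = aeval (x : p.SplittingField) h := Iff.rfl
    have hblock (σ : p.Gal) :
        (fun y => σ • y) '' B = B ∨ Disjoint ((fun y => σ • y) '' B) B := by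
      rw [or_iff_not_imp_right, Set.not_disjoint_iff]
      rintro ⟨_, ⟨y, hy, rfl⟩, hσy⟩
      have hσ : σ (aeval (x : p.SplittingField) h) = aeval (x : p.SplittingField) h := by
        rw [← (hB y).1 hy, ← haeval, ← hsmul, (hB _).1 hσy, (hB y).1 hy]
      ext z
      constructor
      · rintro ⟨w, hw, rfl⟩
        rw [hB, hsmul, haeval, (hB w).1 hw, hσ]
      · intro hz
        refine ⟨σ⁻¹ • z, ?_, smul_inv_smul σ z⟩
        apply EmbeddingLike.injective σ
        rw [← haeval, ← hsmul, smul_inv_smul, hσ]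
        exact hz
    rcases hprim B hblock with hB | hB
    · obtain ⟨a, ha, b, hb, hab⟩ := Finset.one_lt_card.1 (hScard ▸ hh)
      obtain ⟨ha, ha'⟩ := (hS a).1 ha
      obtain ⟨hb, hb'⟩ := (hS b).1 hb
      exact hab (congrArg Subtype.val (@hB ⟨a, ha⟩ ha' ⟨b, hb⟩ hb'))
    · have hle : (p.rootSet p.SplittingField).ncard ≤ S.card := by
        rw [← Set.ncard_coe_finset]
        refine Set.ncard_le_ncard (fun y hy => (hS y).2 ⟨hy, ?_⟩) S.finite_toSet
        exact Set.eq_univ_iff_forall.1 hB ⟨y, hy⟩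
      rw [← Nat.card_coe_set_eq, hcard, hScard, natDegree_comp] at hle
      nlinarith
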